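/- arXiv:math/0608012 — 2 statements merged into one kernel-verified Lean document; each statement's English description precedes it below -/
import Mathlib

section
/- Let f : ℝ^d → [0,∞) be integrable with f = 0 almost everywhere outside the closed unit ball. Fix a unit vector u and an orthogonal matrix A_u with A_u e₁ = u, and for r ∈ [0,1] set E_{(u,r)} := A_u[−1,1]^d + (1+r)u and ℓ_f(u,r) := ∫_{E_{(u,r)}} f(x) dx. Then the function r ↦ ℓ_f(u,r) is nonincreasing on [0,1]. -/
open MeasureTheory Set

/-- The translated rotated cube is the set of points whose rotated-back translate has all
coordinates bounded by `1`. -/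
theorem image_cube_eq {d : ℕ} (A : EuclideanSpace ℝ (Fin d) ≃ₗᵢ[ℝ] EuclideanSpace ℝ (Fin d))
    (c : EuclideanSpace ℝ (Fin d)) :
    (fun y => A y + c) '' {y | ∀ i, |y i| ≤ 1} = {x | ∀ i, |A.symm (x - c) i| ≤ 1} := by
  ext x
  constructor
  · rintro ⟨y, hy, rfl⟩
    simpa using hy
  · intro hx
    exact ⟨A.symm (x - c), hx, by simp⟩

theorem isClosed_image_cube {d : ℕ}
    (A : EuclideanSpace ℝ (Fin d) ≃ₗᵢ[ℝ] EuclideanSpace ℝ (Fin d))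
    (c : EuclideanSpace ℝ (Fin d)) :
    IsClosed ((fun y => A y + c) '' {y | ∀ i, |y i| ≤ 1}) := by
  rw [image_cube_eq, Set.ofPred_forall]
  exact isClosed_iInter fun i => isClosed_le (by fun_prop) continuous_const

/-- Inside the closed unit ball, the cubes shrink as they are moved away along `A e₀`. -/
theorem image_cube_inter_closedBall_subset {d : ℕ} [NeZero d]
    (A : EuclideanSpace ℝ (Fin d) ≃ₗᵢ[ℝ] EuclideanSpace ℝ (Fin d)) {r s : ℝ}
    (hr : 0 ≤ r) (hrs : r ≤ s) :
    (fun y => A y + (1 + s) • A (EuclideanSpace.single 0 1)) '' {y | ∀ i, |y i| ≤ 1} ∩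
        {x | ‖x‖ ≤ 1} ⊆
      (fun y => A y + (1 + r) • A (EuclideanSpace.single 0 1)) '' {y | ∀ i, |y i| ≤ 1} := by
  rw [image_cube_eq, image_cube_eq]
  rintro x ⟨hx, hxn⟩ i
  have hxi := hx i
  have hle : |A.symm x i| ≤ 1 := by
    have h := PiLp.norm_apply_le (A.symm x) i
    rw [Real.norm_eq_abs, A.symm.norm_map] at h
    exact h.trans hxn
  rw [abs_le] at hle
  simp only [map_sub, map_smul, LinearIsometryEquiv.symm_apply_apply, PiLp.sub_apply,
    PiLp.smul_apply, smul_eq_mul, abs_le] at hxi ⊢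
  by_cases hi : i = 0
  · subst hi
    simp only [PiLp.single_apply, if_true, mul_one] at hxi ⊢
    constructor <;> linarith
  · simpa [hi] using hle

/-- The probe functional `r ↦ ∫_{E_{(u,r)}} f` is nonincreasing on `[0,1]` for a
nonnegative integrable `f` vanishing a.e. outside the closed unit ball. -/
theorem stmt12 {d : ℕ} [NeZero d]
    (f : EuclideanSpace ℝ (Fin d) → ℝ) (hf : Integrable f volume)
    (hfnn : ∀ x, 0 ≤ f x)
    (hf0 : ∀ᵐ x ∂volume, 1 < ‖x‖ → f x = 0)
    (u : EuclideanSpace ℝ (Fin d)) (hu : ‖u‖ = 1)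
    (A : EuclideanSpace ℝ (Fin d) ≃ₗᵢ[ℝ] EuclideanSpace ℝ (Fin d))
    (hA : A (EuclideanSpace.single 0 1) = u) :
    AntitoneOn (fun r => ∫ x in (fun y => A y + (1 + r) • u) '' {y | ∀ i, |y i| ≤ 1}, f x)
      (Icc (0:ℝ) 1) := by
  subst hA
  rintro r hr s - hrs
  have hS := (isClosed_image_cube A ((1 + s) • A (EuclideanSpace.single 0 1))).measurableSet
  have hball : ∀ᵐ x ∂volume,
      x ∈ (fun y => A y + (1 + s) • A (EuclideanSpace.single 0 1)) '' {y | ∀ i, |y i| ≤ 1} \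
        ((fun y => A y + (1 + s) • A (EuclideanSpace.single 0 1)) '' {y | ∀ i, |y i| ≤ 1} ∩
          {x | ‖x‖ ≤ 1}) → f x = 0 := by
    filter_upwards [hf0] with x hx hxd
    exact hx (not_le.1 fun h => hxd.2 ⟨hxd.1, h⟩)
  calc ∫ x in (fun y => A y + (1 + s) • A (EuclideanSpace.single 0 1)) ''
          {y | ∀ i, |y i| ≤ 1}, f x
      = ∫ x in (fun y => A y + (1 + s) • A (EuclideanSpace.single 0 1)) ''
          {y | ∀ i, |y i| ≤ 1} ∩ {x | ‖x‖ ≤ 1}, f x :=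
        setIntegral_eq_of_subset_of_ae_sdiff_eq_zero hS.nullMeasurableSet inter_subset_left hball
    _ ≤ ∫ x in (fun y => A y + (1 + r) • A (EuclideanSpace.single 0 1)) ''
          {y | ∀ i, |y i| ≤ 1}, f x :=
        setIntegral_mono_set hf.integrableOn (ae_of_all _ hfnn)
          (image_cube_inter_closedBall_subset A hr.1 hrs).eventuallyLE
end

section
/- Let γ ≥ 0 and c ∈ ℝ, and set g(x₁) := c − x₁². Then for every η > 0: ∫∫_{{(x₁,x₂) ∈ ℝ² : c − η ≤ x₂ ≤ g(x₁)}} (g(x₁) − x₂)^γ dx₁ dx₂ = η^{γ + 3/2} · (1/(γ+1)) ∫_{−1}^{1} (1 − t²)^{γ+1} dt. In particular the integral equals B η^{γ+3/2} for a positive constant B depending only on γ. -/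
open MeasureTheory

/-- The closed set between the horizontal line `x₂ = c − η` and the parabola `x₂ = c − x₁²`
is compact. -/
lemma isCompact_setOf_below_parabola (c η : ℝ) :
    IsCompact {p : ℝ × ℝ | c - η ≤ p.2 ∧ p.2 ≤ c - p.1 ^ 2} := by
  refine (isCompact_Icc.prod isCompact_Icc :
    IsCompact (Set.Icc (-√η) √η ×ˢ Set.Icc (c - η) c)).of_isClosed_subset ?_ ?_
  · exact (isClosed_le continuous_const continuous_snd).inter
      (isClosed_le continuous_snd (continuous_const.sub (continuous_fst.pow 2)))
  · rintro ⟨x, y⟩ ⟨h₁, h₂⟩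
    simp only at h₁ h₂
    have hx : |x| ≤ √η := Real.abs_le_sqrt (by linarith)
    exact ⟨abs_le.mp hx, h₁, by nlinarith [sq_nonneg x]⟩

/-- The integral of `(b − y)^γ` over `[a, b]`. -/
lemma setIntegral_Icc_sub_rpow {γ a b : ℝ} (hγ : 0 ≤ γ) (hab : a ≤ b) :
    ∫ y in Set.Icc a b, (b - y) ^ γ = (γ + 1)⁻¹ * (b - a) ^ (γ + 1) := by
  rw [integral_Icc_eq_integral_Ioc, ← intervalIntegral.integral_of_le hab,
    intervalIntegral.integral_comp_sub_left (fun y => y ^ γ) b, integral_rpow (by left; linarith),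
    sub_self, Real.zero_rpow (by linarith), sub_zero, div_eq_inv_mul]

/-- Rescaling `∫ (η − x²)^s` over `[−√η, √η]` to `[−1, 1]`. -/
lemma integral_sub_sq_rpow {η : ℝ} (hη : 0 < η) (s : ℝ) :
    ∫ x in (-√η)..√η, (η - x ^ 2) ^ s
      = η ^ (s + 1 / 2) * ∫ t in (-1:ℝ)..1, (1 - t ^ 2) ^ s := by
  have h := intervalIntegral.smul_integral_comp_mul_left
    (fun x => (η - x ^ 2) ^ s) √η (a := -1) (b := 1)
  rw [mul_neg, mul_one] at h
  rw [← h, smul_eq_mul, Real.rpow_add hη, ← Real.sqrt_eq_rpow, mul_comm (η ^ s), mul_assoc,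
    ← intervalIntegral.integral_const_mul (η ^ s)]
  congr 1
  refine intervalIntegral.integral_congr fun t ht => ?_
  rw [Set.uIcc_of_le (by norm_num)] at ht
  have ht' : 0 ≤ 1 - t ^ 2 := by nlinarith [ht.1, ht.2]
  rw [← Real.mul_rpow hη.le ht', mul_pow, Real.sq_sqrt hη.le]
  ring_nf

/-- The integral of `(1 − t²)^s` over `[−1, 1]` is positive. -/
lemma integral_one_sub_sq_rpow_pos {s : ℝ} (hs : 0 ≤ s) :
    0 < ∫ t in (-1:ℝ)..1, (1 - t ^ 2) ^ s := by
  refine intervalIntegral.intervalIntegral_pos_of_pos_on ?_ (fun t ht => ?_) (by norm_num)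
  · exact (Continuous.rpow_const (by fun_prop) fun _ => Or.inr hs).intervalIntegrable _ _
  · exact Real.rpow_pos_of_pos (by nlinarith [ht.1, ht.2]) _

/-- Mass accumulated below a parabolic boundary: for `g(x₁) = c − x₁²` and intensity
`(g(x₁) − x₂)^γ`, the integral over the slab `{c − η ≤ x₂ ≤ g(x₁)}` equals
`η^{γ+3/2} (γ+1)⁻¹ ∫_{−1}^{1} (1−t²)^{γ+1} dt`, a positive constant times `η^{γ+3/2}`. -/
theorem stmt16 (γ c : ℝ) (hγ : 0 ≤ γ) :
    (∀ η : ℝ, 0 < η →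
      ∫ p in {p : ℝ × ℝ | c - η ≤ p.2 ∧ p.2 ≤ c - p.1 ^ 2}, (c - p.1 ^ 2 - p.2) ^ γ
        = η ^ (γ + 3 / 2) * ((γ + 1)⁻¹ * ∫ t in (-1:ℝ)..1, (1 - t ^ 2) ^ (γ + 1))) ∧
    0 < (γ + 1)⁻¹ * ∫ t in (-1:ℝ)..1, (1 - t ^ 2) ^ (γ + 1) := by
  refine ⟨fun η hη => ?_,
    mul_pos (by positivity) (integral_one_sub_sq_rpow_pos (by linarith))⟩
  set S := {p : ℝ × ℝ | c - η ≤ p.2 ∧ p.2 ≤ c - p.1 ^ 2}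
  have hSc : IsCompact S := isCompact_setOf_below_parabola c η
  have hSm : MeasurableSet S := hSc.measurableSet
  have hf : Continuous fun p : ℝ × ℝ => (c - p.1 ^ 2 - p.2) ^ γ :=
    Continuous.rpow_const (by fun_prop) fun _ => Or.inr hγ
  have hint := (integrable_indicator_iff hSm).mpr (hf.continuousOn.integrableOn_compact
    (μ := volume) hSc)
  rw [← integral_indicator hSm]
  rw [Measure.volume_eq_prod] at hint ⊢
  rw [integral_prod _ hint]
  have inner (x : ℝ) :
      ∫ y, S.indicator (fun p : ℝ × ℝ => (c - p.1 ^ 2 - p.2) ^ γ) (x, y)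
        = (Set.Icc (-√η) √η).indicator (fun x => (γ + 1)⁻¹ * (η - x ^ 2) ^ (γ + 1)) x := by
    have h : (fun y => S.indicator (fun p : ℝ × ℝ => (c - p.1 ^ 2 - p.2) ^ γ) (x, y))
        = (Set.Icc (c - η) (c - x ^ 2)).indicator fun y => (c - x ^ 2 - y) ^ γ := rfl
    rw [h, integral_indicator measurableSet_Icc]
    by_cases hx : x ∈ Set.Icc (-√η) √η
    · have hx' : x ^ 2 ≤ η := (Real.sq_le hη.le).mpr hx
      rw [Set.indicator_of_mem hx, setIntegral_Icc_sub_rpow hγ (by linarith)]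
      ring_nf
    · have hx' : ¬ x ^ 2 ≤ η := fun h => hx ((Real.sq_le hη.le).mp h)
      rw [Set.indicator_of_notMem hx, Set.Icc_eq_empty (by intro h; exact hx' (by linarith)),
        setIntegral_empty]
  simp_rw [inner]
  rw [integral_indicator measurableSet_Icc, integral_Icc_eq_integral_Ioc,
    ← intervalIntegral.integral_of_le (by linarith [Real.sqrt_nonneg η]),
    intervalIntegral.integral_const_mul, integral_sub_sq_rpow hη,
    show γ + 1 + 1 / 2 = γ + 3 / 2 by ring]
  ring
end
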